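/- arXiv:1511.06308 — 9 statements merged into one kernel-verified Lean document; each statement's English description precedes it below -/
import Mathlib

section
/- Let C be a plane external to the Klein quadric. Then for every point p of P(V) and every line M of P(V) there is exactly one line N of P(V) with p ≤ N and N ∥_C M. (Together with the fact that ∥_C is an equivalence relation, this says ∥_C is a parallelism of P(V).) -/
open ExteriorAlgebra

variable (F : Type*) [Field F] (V : Type*) [AddCommGroup V] [Module F V]

/-- An element of the second exterior power `⋀²V` is decomposable if it is the wedge
`u ∧ v` of two vectors of `V`. -/
def IsDecomposable (x : ⋀[F]^2 V) : Prop :=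
  ∃ u v : V, (x : ExteriorAlgebra F V) = ι F u * ι F v

/-- A plane external to the Klein quadric: a 3-dimensional subspace of `⋀²V` containing
no nonzero decomposable element. -/
def IsExternalPlane (C : Submodule F ↥(⋀[F]^2 V)) : Prop :=
  Module.finrank F C = 3 ∧ ∀ x ∈ C, x ≠ 0 → ¬ IsDecomposable F V x

/-- The Plücker point `γM` of a line `M` of `P(V)`: the subspace of `⋀²V` spanned by all
wedges `u ∧ v` with `u, v ∈ M`.  For a 2-dimensional `M` this is the 1-dimensional
subspace spanned by `u ∧ v`, where `{u, v}` is any basis of `M`. -/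
def plueckerPoint (M : Submodule F V) : Submodule F ↥(⋀[F]^2 V) :=
  Submodule.span F {x : ⋀[F]^2 V | ∃ u ∈ M, ∃ v ∈ M, (x : ExteriorAlgebra F V) = ι F u * ι F v}

/-- The polar `X^⊥` of a subspace `X` of `⋀²V` with respect to the Klein quadric:
all `y` with `x ∧ y = 0` for every `x ∈ X`, the wedge being computed in the
exterior algebra of `V` (it lands in the 1-dimensional space `⋀⁴V`). -/
def polarSubspace (X : Submodule F ↥(⋀[F]^2 V)) : Submodule F ↥(⋀[F]^2 V) where
  carrier := {y | ∀ x ∈ X, (x : ExteriorAlgebra F V) * (y : ExteriorAlgebra F V) = 0}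
  add_mem' := by
    intro a b ha hb x hx
    rw [Submodule.coe_add, mul_add, ha x hx, hb x hx, add_zero]
  zero_mem' := by
    intro x hx
    simp
  smul_mem' := by
    intro c a ha x hx
    rw [Submodule.coe_smul, Algebra.mul_smul_comm, ha x hx, smul_zero]

section Wedge

variable {F V}

/-- The linear map `v ↦ a ∧ v` from `V` to `⋀²V`. -/
noncomputable def wedgeLeft (a : V) : V →ₗ[F] ↥(⋀[F]^2 V) :=
  ((LinearMap.mulLeft F (ι F a)).comp (ι F)).codRestrict _ fun v => by
    rw [exteriorPower, pow_two]
    exact Submodule.mul_mem_mul (LinearMap.mem_range_self _ a) (LinearMap.mem_range_self _ v)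

@[simp]
theorem coe_wedgeLeft (a v : V) : (wedgeLeft (F := F) a v : ExteriorAlgebra F V) = ι F a * ι F v :=
  rfl

theorem wedgeLeft_self (a : V) : wedgeLeft (F := F) a a = 0 :=
  Subtype.ext (ι_sq_zero a)

theorem isDecomposable_wedgeLeft (a v : V) : IsDecomposable F V (wedgeLeft a v) :=
  ⟨a, v, rfl⟩

/-- The kernel of `a ∧ ·` is spanned by `a`, for nonzero `a`. -/
theorem ker_wedgeLeft {a : V} (ha : a ≠ 0) :
    LinearMap.ker (wedgeLeft (F := F) a) = Submodule.span F {a} := by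
  apply le_antisymm
  · intro v hv
    obtain ⟨f, hf⟩ := Module.Projective.exists_dual_eq_one F ha
    have h : ι F a * ι F v = 0 := congrArg Subtype.val (LinearMap.mem_ker.1 hv)
    have h' := CliffordAlgebra.contractLeft_ι_mul (Q := (0 : QuadraticForm F V)) f a (ι F v)
    erw [h, map_zero, CliffordAlgebra.contractLeft_ι, hf, one_smul, ← Algebra.commutes,
      ← Algebra.smul_def, eq_comm, sub_eq_zero, ← map_smul] at h'
    exact Submodule.mem_span_singleton.2 ⟨f v, (ι_leftInverse.injective h').symm⟩
  · rw [Submodule.span_singleton_le_iff_mem]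
    exact wedgeLeft_self a

theorem finrank_range_wedgeLeft [FiniteDimensional F V] {a : V} (ha : a ≠ 0) :
    Module.finrank F (LinearMap.range (wedgeLeft (F := F) a)) + 1 = Module.finrank F V := by
  rw [← LinearMap.finrank_range_add_finrank_ker (wedgeLeft (F := F) a), ker_wedgeLeft ha,
    finrank_span_singleton ha]

/-- The Plücker point of the span of two vectors is spanned by their wedge. -/
theorem plueckerPoint_span_pair (u v : V) :
    plueckerPoint F V (Submodule.span F {u, v}) = Submodule.span F {wedgeLeft u v} := by
  apply le_antisymm
  · refine Submodule.span_le.2 ?_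
    rintro x ⟨y, hy, z, hz, hx⟩
    obtain ⟨α, β, rfl⟩ := Submodule.mem_span_pair.1 hy
    obtain ⟨γ, δ, rfl⟩ := Submodule.mem_span_pair.1 hz
    refine Submodule.mem_span_singleton.2 ⟨α * δ - β * γ, Subtype.ext ?_⟩
    have h : ι F v * ι F u = -(ι F u * ι F v) :=
      eq_neg_of_add_eq_zero_left (ι_add_mul_swap v u)
    rw [hx]
    simp only [Submodule.coe_smul, coe_wedgeLeft, map_add, map_smul, add_mul, mul_add,
      smul_mul_smul_comm, ι_sq_zero, h]
    module
  · rw [Submodule.span_singleton_le_iff_mem]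
    exact Submodule.subset_span
      ⟨u, Submodule.subset_span (by simp), v, Submodule.subset_span (by simp), rfl⟩

theorem finrank_span_pair {a v : V} (ha : a ≠ 0) (hv : v ∉ Submodule.span F {a}) :
    Module.finrank F (Submodule.span F {a, v}) = 2 := by
  rw [← Matrix.range_cons_cons_empty a v ![], finrank_span_eq_card, Fintype.card_fin]
  exact (LinearIndependent.pair_iff' ha).2 fun c hc =>
    hv (Submodule.mem_span_singleton.2 ⟨c, hc⟩)

/-- A line is spanned by any nonzero vector in it together with some other vector. -/
theorem exists_eq_span_pair_of_mem {N : Submodule F V} (hN : Module.finrank F N = 2)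
    {a : V} (ha : a ≠ 0) (haN : a ∈ N) :
    ∃ v, N = Submodule.span F {a, v} ∧ v ∉ Submodule.span F {a} := by
  have : Module.Finite F N := Module.finite_of_finrank_pos (by omega)
  have hlt : ¬ N ≤ Submodule.span F {a} := fun hle => by
    have h := Submodule.finrank_mono hle
    rw [hN, finrank_span_singleton ha] at h
    omega
  obtain ⟨v, hvN, hv⟩ := SetLike.not_le_iff_exists.1 hlt
  refine ⟨v, (Submodule.eq_of_le_of_finrank_eq ?_ ?_).symm, hv⟩
  · exact Submodule.span_le.2 (by rintro x (rfl | rfl) <;> assumption)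
  · rw [hN, finrank_span_pair ha hv]

theorem IsExternalPlane.eq_zero_of_mem {C : Submodule F ↥(⋀[F]^2 V)}
    (hC : IsExternalPlane F V C) {a v : V} (h : wedgeLeft a v ∈ C) :
    wedgeLeft (F := F) a v = 0 :=
  by_contra fun h0 => hC.2 _ h h0 (isDecomposable_wedgeLeft a v)

/-- The wedges with a fixed nonzero vector form a complement of an external plane. -/
theorem IsExternalPlane.isCompl_range_wedgeLeft [FiniteDimensional F V]
    (hV : Module.finrank F V = 4) {C : Submodule F ↥(⋀[F]^2 V)}
    (hC : IsExternalPlane F V C) {a : V} (ha : a ≠ 0) :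
    IsCompl C (LinearMap.range (wedgeLeft (F := F) a)) := by
  have hdisj : Disjoint C (LinearMap.range (wedgeLeft (F := F) a)) := by
    rw [Submodule.disjoint_def]
    rintro _ hx ⟨v, rfl⟩
    exact hC.eq_zero_of_mem hx
  refine ⟨hdisj, codisjoint_iff.2 (Submodule.eq_top_of_disjoint _ _ ?_ hdisj)⟩
  have h1 := finrank_range_wedgeLeft (F := F) ha
  have h2 : Module.finrank F ↥(⋀[F]^2 V) = 6 := by
    rw [exteriorPower.finrank_eq, hV]
    rfl
  rw [hC.1]
  omega

end Wedge

/-- For a plane `C` external to the Klein quadric, through every point `p` there is exactly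
one line `N` that is `C`-parallel to a given line `M`; hence `∥_C` is a parallelism. -/
theorem cParallel_is_parallelism
    [FiniteDimensional F V] (hV : Module.finrank F V = 4)
    (C : Submodule F ↥(⋀[F]^2 V)) (hC : IsExternalPlane F V C) :
    ∀ p M : Submodule F V, Module.finrank F p = 1 → Module.finrank F M = 2 →
      ∃! N : Submodule F V, Module.finrank F N = 2 ∧ p ≤ N ∧
        C ⊔ plueckerPoint F V N = C ⊔ plueckerPoint F V M := by
  intro p M hp hM
  obtain ⟨a, ha, rfl⟩ : ∃ a : V, a ≠ 0 ∧ p = Submodule.span F {a} := by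
    obtain ⟨a, hap, ha⟩ := p.exists_mem_ne_zero_of_ne_bot (by rintro rfl; simp at hp)
    refine ⟨a, ha, (Submodule.eq_of_le_of_finrank_eq ?_ ?_).symm⟩
    · rwa [Submodule.span_singleton_le_iff_mem]
    · rw [hp, finrank_span_singleton ha]
  obtain ⟨m, hmM, hm⟩ := M.exists_mem_ne_zero_of_ne_bot (by rintro rfl; simp at hM)
  obtain ⟨n, rfl, hn⟩ := exists_eq_span_pair_of_mem hM hm hmM
  obtain ⟨c, hc, _, ⟨v, rfl⟩, hcv⟩ := Submodule.mem_sup.1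
    ((hC.isCompl_range_wedgeLeft hV ha).sup_eq_top ▸ Submodule.mem_top :
      wedgeLeft m n ∈ C ⊔ LinearMap.range (wedgeLeft (F := F) a))
  have hsup : C ⊔ Submodule.span F {wedgeLeft a v} = C ⊔ Submodule.span F {wedgeLeft m n} := by
    apply le_antisymm <;> refine sup_le le_sup_left ?_ <;>
      rw [Submodule.span_singleton_le_iff_mem]
    · rw [← add_sub_cancel_left c (wedgeLeft a v), hcv]
      exact sub_mem (Submodule.mem_sup_right (Submodule.mem_span_singleton_self _))
        (Submodule.mem_sup_left hc)
    · rw [← hcv]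
      exact add_mem (Submodule.mem_sup_left hc)
        (Submodule.mem_sup_right (Submodule.mem_span_singleton_self _))
  have hv : v ∉ Submodule.span F {a} := by
    intro hv
    rw [← ker_wedgeLeft ha, LinearMap.mem_ker] at hv
    rw [hv, add_zero] at hcv
    refine hn ?_
    rw [← ker_wedgeLeft hm]
    exact hC.eq_zero_of_mem (hcv ▸ hc)
  refine ⟨Submodule.span F {a, v}, ⟨finrank_span_pair ha hv,
    Submodule.span_mono (by simp), ?_⟩, ?_⟩
  · rw [plueckerPoint_span_pair, plueckerPoint_span_pair, hsup]
  · rintro N ⟨hN, haN, hCN⟩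
    obtain ⟨w, rfl, -⟩ := exists_eq_span_pair_of_mem hN ha
      ((Submodule.span_singleton_le_iff_mem _ _).1 haN)
    rw [plueckerPoint_span_pair, plueckerPoint_span_pair, ← hsup] at hCN
    refine Submodule.eq_of_le_of_finrank_eq ?_ (hN.trans (finrank_span_pair ha hv).symm)
    have hw : wedgeLeft a w ∈ C ⊔ Submodule.span F {wedgeLeft a v} :=
      hCN ▸ Submodule.mem_sup_right (Submodule.mem_span_singleton_self _)
    obtain ⟨d, hd, _, hy, hdw⟩ := Submodule.mem_sup.1 hw
    obtain ⟨t, rfl⟩ := Submodule.mem_span_singleton.1 hy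
    have hker : w - t • v ∈ Submodule.span F {a} := by
      rw [← ker_wedgeLeft ha]
      apply hC.eq_zero_of_mem
      rwa [map_sub, map_smul, ← hdw, add_sub_cancel_right]
    obtain ⟨s, hs⟩ := Submodule.mem_span_singleton.1 hker
    refine Submodule.span_le.2 ?_
    rintro x (rfl | rfl)
    · exact Submodule.subset_span (by simp)
    · exact Submodule.mem_span_pair.2 ⟨s, t, by rw [hs, sub_add_cancel]⟩
end

section
/- Let C be a plane external to the Klein quadric and let M be a line of P(V). Then the 4-dimensional subspace C + γM of ⋀²V contains no 2-dimensional subspace all of whose elements are decomposable. (Hence the section of the Klein quadric by the solid C + γM is an elliptic quadric, so each parallel class of ∥_C is a regular spread.) -/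
open ExteriorAlgebra

variable (F : Type*) [Field F] (V : Type*) [AddCommGroup V] [Module F V]

variable {F V} in
/-- The Plücker point of `M` is the image of `⋀²M` in `⋀²V`. -/
theorem plueckerPoint_eq_range (M : Submodule F V) :
    plueckerPoint F V M = LinearMap.range (exteriorPower.map 2 M.subtype) := by
  rw [LinearMap.range_eq_map, ← exteriorPower.ιMulti_span F 2 M, Submodule.map_span,
    plueckerPoint]
  congr 1
  ext x
  simp only [Set.mem_ofPred_eq, ← Set.range_comp, Set.mem_range, Function.comp_apply,
    exteriorPower.map_apply_ιMulti, Subtype.ext_iff, exteriorPower.ιMulti_apply_coe,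
    ExteriorAlgebra.ιMulti_apply]
  constructor
  · rintro ⟨u, hu, v, hv, h⟩
    exact ⟨![⟨u, hu⟩, ⟨v, hv⟩], by simp [h]⟩
  · rintro ⟨a, ha⟩
    exact ⟨a 0, (a 0).2, a 1, (a 1).2, by simp [← ha]⟩

variable {F V} in
theorem finrank_plueckerPoint {M : Submodule F V} (hM : Module.finrank F M = 2) :
    Module.finrank F (plueckerPoint F V M) = 1 := by
  have : FiniteDimensional F M := Module.finite_of_finrank_pos (by omega)
  rw [plueckerPoint_eq_range, LinearMap.finrank_range_of_inj
    (exteriorPower.map_injective_field M.injective_subtype), exteriorPower.finrank_eq, hM,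
    Nat.choose_self]

variable {F V} in
theorem IsDecomposable.smul {x : ⋀[F]^2 V} (hx : IsDecomposable F V x) (c : F) :
    IsDecomposable F V (c • x) := by
  obtain ⟨u, v, h⟩ := hx
  exact ⟨c • u, v, by rw [Submodule.coe_smul, h, map_smul, smul_mul_assoc]⟩

variable {F V} in
theorem isDecomposable_of_mem_plueckerPoint {M : Submodule F V} (hM : Module.finrank F M = 2)
    {x : ⋀[F]^2 V} (hx : x ∈ plueckerPoint F V M) : IsDecomposable F V x := by
  have h1 := finrank_plueckerPoint hM
  obtain ⟨w, ⟨u, hu, v, hv, hw⟩, hw0⟩ : ∃ w : ⋀[F]^2 V,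
      (∃ u ∈ M, ∃ v ∈ M, (w : ExteriorAlgebra F V) = ι F u * ι F v) ∧ w ≠ 0 := by
    by_contra! h
    have : plueckerPoint F V M = ⊥ := Submodule.span_eq_bot.2 h
    rw [this, finrank_bot] at h1
    omega
  have hwM : w ∈ plueckerPoint F V M := Submodule.subset_span ⟨u, hu, v, hv, hw⟩
  have hw0' : (⟨w, hwM⟩ : plueckerPoint F V M) ≠ 0 := fun h => hw0 (congrArg Subtype.val h)
  obtain ⟨c, hc⟩ :=
    (finrank_eq_one_iff_of_nonzero' (K := F) (V := plueckerPoint F V M) _ hw0').1 h1 ⟨x, hx⟩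
  have hcx : c • w = x := congrArg Subtype.val hc
  exact hcx ▸ IsDecomposable.smul ⟨u, v, hw⟩ c

/-- For a plane `C` external to the Klein quadric and a line `M`, the 4-dimensional subspace
`C + γM` of `⋀²V` contains no 2-dimensional subspace all of whose elements are decomposable
(so the section of the Klein quadric by this solid is an elliptic quadric). -/
theorem no_line_on_quadric_in_solid
    [FiniteDimensional F V] (hV : Module.finrank F V = 4)
    (C : Submodule F ↥(⋀[F]^2 V)) (hC : IsExternalPlane F V C)
    (M : Submodule F V) (hM : Module.finrank F M = 2) :
    Module.finrank F ↥(C ⊔ plueckerPoint F V M) = 4 ∧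
      ∀ D : Submodule F ↥(⋀[F]^2 V), Module.finrank F D = 2 →
        D ≤ C ⊔ plueckerPoint F V M → ¬ (∀ x ∈ D, IsDecomposable F V x) := by
  obtain ⟨hC3, hCd⟩ := hC
  have hdisj : C ⊓ plueckerPoint F V M = ⊥ := by
    refine (Submodule.eq_bot_iff _).2 fun x hx => ?_
    by_contra hx0
    exact hCd x hx.1 hx0 (isDecomposable_of_mem_plueckerPoint hM hx.2)
  have h4 : Module.finrank F ↥(C ⊔ plueckerPoint F V M) = 4 := by
    have h := Submodule.finrank_sup_add_finrank_inf_eq C (plueckerPoint F V M)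
    rwa [hdisj, finrank_bot, hC3, finrank_plueckerPoint hM] at h
  refine ⟨h4, fun D hD2 hD hdec => ?_⟩
  have hCD : C ⊓ D = ⊥ := by
    refine (Submodule.eq_bot_iff _).2 fun x hx => ?_
    by_contra hx0
    exact hCd x hx.1 hx0 (hdec x hx.2)
  have h := Submodule.finrank_sup_add_finrank_inf_eq C D
  rw [hCD, finrank_bot] at h
  have hle := Submodule.finrank_mono (sup_le (le_sup_left : C ≤ C ⊔ plueckerPoint F V M) hD)
  omega
end

section
/- Let C be a plane external to the Klein quadric and let M be a line of P(V). Then C + γM is a 4-dimensional subspace of ⋀²V containing C, and for every line N of P(V) one has N ∥_C M if and only if γN ≤ C + γM. (Thus each parallel class of ∥_C is the set of lines whose Plücker points lie in a uniquely determined solid through C.) -/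
open ExteriorAlgebra

variable (F : Type*) [Field F] (V : Type*) [AddCommGroup V] [Module F V]

variable {F V} in
/-- The wedge of a linearly independent family is nonzero. -/
theorem exteriorPower.ιMulti_ne_zero_of_linearIndependent {n : ℕ} {v : Fin n → V}
    (hv : LinearIndependent F v) : exteriorPower.ιMulti F n v ≠ 0 := by
  let s : Set.powersetCard (Fin n) n := Set.powersetCard.ofFinEmbEquiv (RelEmbedding.refl _)
  have h := (exteriorPower.ιMulti_family_linearIndependent_field (n := n) hv).ne_zero s
  simpa [exteriorPower.ιMulti_family, s, Function.comp_def] using h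

theorem exteriorPower.coe_ιMulti_two (v : Fin 2 → V) :
    (exteriorPower.ιMulti F 2 v : ExteriorAlgebra F V) = ι F (v 0) * ι F (v 1) := by
  simp [ExteriorAlgebra.ιMulti_apply, Matrix.vecTail]

/-- The Plücker point of a line is spanned by the wedge of any basis of the line. -/
theorem plueckerPoint_eq_span_singleton (M : Submodule F V) (b : Module.Basis (Fin 2) F M) :
    plueckerPoint F V M = F ∙ exteriorPower.ιMulti F 2 (fun i ↦ (b i : V)) := by
  apply le_antisymm
  · refine Submodule.span_le.2 ?_
    rintro x ⟨u, hu, v, hv, hx⟩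
    have key (w : V) (hw : w ∈ M) : ∃ p q : F, w = p • (b 0 : V) + q • (b 1 : V) := by
      refine ⟨b.repr ⟨w, hw⟩ 0, b.repr ⟨w, hw⟩ 1, ?_⟩
      have h := congrArg Subtype.val (b.sum_repr ⟨w, hw⟩)
      rw [Fin.sum_univ_two] at h
      exact h.symm
    obtain ⟨p, q, rfl⟩ := key u hu
    obtain ⟨r, s, rfl⟩ := key v hv
    refine Submodule.mem_span_singleton.2 ⟨p * s - q * r, Subtype.ext ?_⟩
    have hswap : ι F (b 1 : V) * ι F (b 0 : V) = -(ι F (b 0 : V) * ι F (b 1 : V)) :=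
      eq_neg_of_add_eq_zero_left (ι_add_mul_swap _ _)
    rw [hx, Submodule.coe_smul, exteriorPower.coe_ιMulti_two]
    simp only [map_add, map_smul, add_mul, mul_add, smul_mul_smul_comm, ι_sq_zero, hswap]
    module
  · refine (Submodule.span_singleton_le_iff_mem _ _).2 (Submodule.subset_span ?_)
    exact ⟨b 0, (b 0).2, b 1, (b 1).2, exteriorPower.coe_ιMulti_two F V _⟩

variable {F V} in
/-- Joining an external plane with the Plücker point of a line gives a solid. -/
theorem IsExternalPlane.finrank_sup_plueckerPoint [FiniteDimensional F V]
    {C : Submodule F ↥(⋀[F]^2 V)} (hC : IsExternalPlane F V C)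
    {M : Submodule F V} (hM : Module.finrank F M = 2) :
    Module.finrank F ↥(C ⊔ plueckerPoint F V M) = 4 := by
  let b := Module.finBasisOfFinrankEq F M hM
  have hw : exteriorPower.ιMulti F 2 (fun i ↦ (b i : V)) ≠ 0 :=
    exteriorPower.ιMulti_ne_zero_of_linearIndependent
      (b.linearIndependent.map' M.subtype M.ker_subtype)
  rw [plueckerPoint_eq_span_singleton F V M b]
  have hdisj : Disjoint C (F ∙ exteriorPower.ιMulti F 2 (fun i ↦ (b i : V))) :=
    (Submodule.disjoint_span_singleton' hw).2 fun h ↦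
      hC.2 _ h hw ⟨b 0, b 1, exteriorPower.coe_ιMulti_two F V _⟩
  have h := Submodule.finrank_sup_add_finrank_inf_eq C
    (F ∙ exteriorPower.ιMulti F 2 (fun i ↦ (b i : V)))
  rwa [hdisj.eq_bot, finrank_bot, hC.1, finrank_span_singleton hw] at h

/-- For a plane `C` external to the Klein quadric and a line `M`, the subspace `C + γM` is a
solid through `C`, and a line `N` is `C`-parallel to `M` iff its Plücker point lies in
`C + γM`. -/
theorem parallel_class_is_solid_section
    [FiniteDimensional F V] (hV : Module.finrank F V = 4)
    (C : Submodule F ↥(⋀[F]^2 V)) (hC : IsExternalPlane F V C)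
    (M : Submodule F V) (hM : Module.finrank F M = 2) :
    Module.finrank F ↥(C ⊔ plueckerPoint F V M) = 4 ∧
      C ≤ C ⊔ plueckerPoint F V M ∧
      ∀ N : Submodule F V, Module.finrank F N = 2 →
        (C ⊔ plueckerPoint F V N = C ⊔ plueckerPoint F V M ↔
          plueckerPoint F V N ≤ C ⊔ plueckerPoint F V M) := by
  refine ⟨hC.finrank_sup_plueckerPoint hM, le_sup_left, fun N hN ↦
    ⟨fun h ↦ h ▸ le_sup_right, fun h ↦ ?_⟩⟩
  refine Submodule.eq_of_le_of_finrank_eq (sup_le le_sup_left h) ?_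
  rw [hC.finrank_sup_plueckerPoint hN, hC.finrank_sup_plueckerPoint hM]
end

section
/- Let C be a plane external to the Klein quadric. If M and N are lines of P(V) that are not C-parallel, then (C + γM) ∩ (C + γN) = C. (Hence the plane C can be uniquely recovered from any two distinct parallel classes of ∥_C.) -/
open ExteriorAlgebra

variable (F : Type*) [Field F] (V : Type*) [AddCommGroup V] [Module F V]

theorem ι_mul_ι_swap (u v : V) : ι F v * ι F u = -(ι F u * ι F v) :=
  eq_neg_of_add_eq_zero_left (ι_add_mul_swap v u)

theorem ι_mul_ι_linear_combination (u v : V) (a b c d : F) :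
    ι F (a • u + b • v) * ι F (c • u + d • v) = (a * d - b * c) • (ι F u * ι F v) := by
  simp only [map_add, map_smul, add_mul, mul_add, smul_mul_assoc, mul_smul_comm, ι_sq_zero,
    smul_zero, ι_mul_ι_swap F V u v]
  module

/-- The Plücker point of a line is spanned by a single bivector. -/
theorem exists_plueckerPoint_eq_span_singleton {M : Submodule F V}
    (hM : Module.finrank F M = 2) :
    ∃ x : ⋀[F]^2 V, plueckerPoint F V M = F ∙ x := by
  have : Module.Finite F M := Module.finite_of_finrank_eq_succ hM
  let e := Module.finBasisOfFinrankEq F M hM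
  have he (w : V) (hw : w ∈ M) : ∃ a b : F, w = a • (e 0 : V) + b • (e 1 : V) := by
    refine ⟨e.repr ⟨w, hw⟩ 0, e.repr ⟨w, hw⟩ 1, ?_⟩
    have h := congrArg M.subtype (e.sum_repr ⟨w, hw⟩)
    rw [Fin.sum_univ_two, map_add, map_smul, map_smul] at h
    exact h.symm
  have hmem : ι F (e 0 : V) * ι F (e 1 : V) ∈ ⋀[F]^2 V := by
    rw [exteriorPower, pow_two]
    exact Submodule.mul_mem_mul (LinearMap.mem_range_self _ _) (LinearMap.mem_range_self _ _)
  refine ⟨⟨_, hmem⟩, le_antisymm (Submodule.span_le.2 ?_) (Submodule.span_mono ?_)⟩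
  · rintro x ⟨u, hu, v, hv, hx⟩
    obtain ⟨a, b, rfl⟩ := he u hu
    obtain ⟨c, d, rfl⟩ := he v hv
    refine Submodule.mem_span_singleton.2 ⟨a * d - b * c, Subtype.ext ?_⟩
    rw [hx, ι_mul_ι_linear_combination]
    rfl
  · rintro _ rfl
    exact ⟨e 0, (e 0).2, e 1, (e 1).2, rfl⟩

/-- Two distinct extensions of a subspace by one vector meet in that subspace. -/
theorem sup_span_singleton_inf_sup_span_singleton {W : Type*} [AddCommGroup W] [Module F W]
    {C : Submodule F W} {x y : W} (h : C ⊔ F ∙ x ≠ C ⊔ F ∙ y) :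
    (C ⊔ F ∙ x) ⊓ (C ⊔ F ∙ y) = C := by
  refine le_antisymm ?_ (le_inf le_sup_left le_sup_left)
  rintro z ⟨hzx, hzy⟩
  by_contra hz
  have key {w : W} (hzw : z ∈ C ⊔ F ∙ w) : C ⊔ F ∙ w = C ⊔ F ∙ z := by
    obtain ⟨c, hc, v, hv, rfl⟩ := Submodule.mem_sup.1 hzw
    obtain ⟨s, rfl⟩ := Submodule.mem_span_singleton.1 hv
    have hs : s ≠ 0 := fun hs => hz (by simpa [hs] using hc)
    refine le_antisymm (sup_le le_sup_left ?_) (sup_le le_sup_left ?_)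
    · rw [Submodule.span_singleton_le_iff_mem, ← Submodule.smul_mem_iff _ hs,
        ← Submodule.add_mem_iff_right _ (Submodule.mem_sup_left hc)]
      exact Submodule.mem_sup_right (Submodule.mem_span_singleton_self _)
    · rwa [Submodule.span_singleton_le_iff_mem]
  exact h ((key hzx).trans (key hzy).symm)

/-- For a plane `C` external to the Klein quadric, the solids determined by two non-parallel
lines meet exactly in `C`; hence `C` can be recovered from any two distinct parallel
classes of `∥_C`. -/
theorem solids_of_nonparallel_lines_meet_in_C
    [FiniteDimensional F V] (hV : Module.finrank F V = 4)
    (C : Submodule F ↥(⋀[F]^2 V)) (hC : IsExternalPlane F V C)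
    (M N : Submodule F V) (hM : Module.finrank F M = 2) (hN : Module.finrank F N = 2)
    (hnpar : C ⊔ plueckerPoint F V M ≠ C ⊔ plueckerPoint F V N) :
    (C ⊔ plueckerPoint F V M) ⊓ (C ⊔ plueckerPoint F V N) = C := by
  obtain ⟨x, hx⟩ := exists_plueckerPoint_eq_span_singleton F V hM
  obtain ⟨y, hy⟩ := exists_plueckerPoint_eq_span_singleton F V hN
  rw [hx, hy] at hnpar ⊢
  exact sup_span_singleton_inf_sup_span_singleton F hnpar
end

section
/- Let C be a plane external to the Klein quadric and suppose the characteristic of F is 2. Then either C ∩ C^⊥ is 1-dimensional (a single point of P(⋀²V)) or C = C^⊥. -/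
open ExteriorAlgebra

variable (F : Type*) [Field F] (V : Type*) [AddCommGroup V] [Module F V]

/-- The coordinate of `x ∧ y` with respect to the top basis vector of the exterior algebra
determined by a basis of a 4-dimensional space, as a bilinear form in `x, y ∈ ⋀²V`. -/
noncomputable def wedgeForm {F V : Type*} [Field F] [AddCommGroup V] [Module F V]
    (b : Module.Basis (Fin 4) F V) : LinearMap.BilinForm F (⋀[F]^2 V) :=
  ((LinearMap.mul F (ExteriorAlgebra F V)).compr₂
    (b.ExteriorAlgebra.coord Finset.univ)).compl₁₂
      (Submodule.subtype _) (Submodule.subtype _)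

section WedgeForm

variable {F V : Type*} [Field F] [AddCommGroup V] [Module F V] (b : Module.Basis (Fin 4) F V)

lemma wedgeForm_apply (x y : ⋀[F]^2 V) :
    wedgeForm b x y =
      b.ExteriorAlgebra.coord Finset.univ ((x : ExteriorAlgebra F V) * (y : ExteriorAlgebra F V)) :=
  rfl

lemma exteriorPower_basis_mul_of_disjoint [CharP F 2] {s t : Set.powersetCard (Fin 4) 2}
    (h : Disjoint s.val t.val) :
    (b.exteriorPower 2 s : ExteriorAlgebra F V) * (b.exteriorPower 2 t : ExteriorAlgebra F V) =
      b.ExteriorAlgebra Finset.univ := by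
  have hu : ((Set.powersetCard.disjUnion h : Set.powersetCard (Fin 4) (2 + 2)) : Finset (Fin 4)) =
      Finset.univ :=
    Finset.eq_univ_of_card _ (Set.powersetCard.card_eq _)
  have hneg : -b.ExteriorAlgebra Finset.univ = b.ExteriorAlgebra Finset.univ := by
    rw [← neg_one_smul F, CharTwo.neg_eq, one_smul]
  rw [← ExteriorAlgebra.basis_eq_coe_basis, ← ExteriorAlgebra.basis_eq_coe_basis,
    ExteriorAlgebra.basis_mul_of_disjoint b s t h, hu]
  rcases Int.units_eq_one_or (Set.powersetCard.permOfDisjoint h).sign with hs | hs <;>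
    simp [hs, hneg]

lemma exteriorPower_basis_mul_of_not_disjoint {s t : Set.powersetCard (Fin 4) 2}
    (h : ¬Disjoint s.val t.val) :
    (b.exteriorPower 2 s : ExteriorAlgebra F V) * (b.exteriorPower 2 t : ExteriorAlgebra F V) =
      0 := by
  rw [← ExteriorAlgebra.basis_eq_coe_basis, ← ExteriorAlgebra.basis_eq_coe_basis,
    ExteriorAlgebra.basis_mul_of_not_disjoint b s t h]

lemma wedgeForm_basis [CharP F 2] (s t : Set.powersetCard (Fin 4) 2) :
    wedgeForm b (b.exteriorPower 2 s) (b.exteriorPower 2 t) =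
      if Disjoint s.val t.val then 1 else 0 := by
  rw [wedgeForm_apply]
  split_ifs with h
  · rw [exteriorPower_basis_mul_of_disjoint b h]
    simp
  · rw [exteriorPower_basis_mul_of_not_disjoint b h, map_zero]

lemma mul_eq_wedgeForm_smul [CharP F 2] (x y : ⋀[F]^2 V) :
    (x : ExteriorAlgebra F V) * (y : ExteriorAlgebra F V) =
      wedgeForm b x y • b.ExteriorAlgebra Finset.univ := by
  suffices h : (LinearMap.mul F (ExteriorAlgebra F V)).compl₁₂
      (Submodule.subtype (⋀[F]^2 V)) (Submodule.subtype (⋀[F]^2 V)) =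
      (wedgeForm b).compr₂ (LinearMap.toSpanSingleton F _ (b.ExteriorAlgebra Finset.univ)) from
    LinearMap.congr_fun₂ h x y
  refine LinearMap.ext_basis (b.exteriorPower 2) (b.exteriorPower 2) fun s t => ?_
  change (b.exteriorPower 2 s : ExteriorAlgebra F V) * (b.exteriorPower 2 t : ExteriorAlgebra F V) =
    wedgeForm b (b.exteriorPower 2 s) (b.exteriorPower 2 t) • b.ExteriorAlgebra Finset.univ
  rw [wedgeForm_basis]
  split_ifs with h
  · rw [exteriorPower_basis_mul_of_disjoint b h, one_smul]
  · rw [exteriorPower_basis_mul_of_not_disjoint b h, zero_smul]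

lemma wedgeForm_comm [CharP F 2] (x y : ⋀[F]^2 V) : wedgeForm b x y = wedgeForm b y x := by
  suffices h : wedgeForm b = (wedgeForm b).flip from LinearMap.congr_fun₂ h x y
  refine LinearMap.ext_basis (b.exteriorPower 2) (b.exteriorPower 2) fun s t => ?_
  rw [LinearMap.BilinForm.flip_apply, wedgeForm_basis, wedgeForm_basis]
  simp only [disjoint_comm]

lemma wedgeForm_isAlt [CharP F 2] : (wedgeForm b).IsAlt := by
  intro x
  induction (b.exteriorPower 2).mem_span x using Submodule.span_induction with
  | zero => simp
  | mem x hx =>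
    obtain ⟨s, rfl⟩ := hx
    rw [wedgeForm_basis, if_neg]
    rw [disjoint_self, Finset.bot_eq_empty, ← Finset.card_eq_zero, Set.powersetCard.card_eq]
    decide
  | add x y _ _ hx hy =>
    simp only [map_add, LinearMap.add_apply, hx, hy, wedgeForm_comm b y x]
    simp [CharTwo.add_self_eq_zero]
  | smul c x _ hx => simp [hx]

lemma wedgeForm_nondegenerate [CharP F 2] : (wedgeForm b).Nondegenerate := by
  refine (wedgeForm_isAlt b).isRefl.nondegenerate_iff_separatingLeft.mpr ?_
  intro x hx
  refine (b.exteriorPower 2).ext_elem fun s => ?_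
  let t : Set.powersetCard (Fin 4) 2 := Set.powersetCard.compl (by simp) s
  have key : (wedgeForm b).flip (b.exteriorPower 2 t) = (b.exteriorPower 2).coord s := by
    refine (b.exteriorPower 2).ext fun r => ?_
    have hr : Disjoint r.val t.val ↔ r = s := by
      rw [Set.powersetCard.coe_compl, disjoint_compl_right_iff]
      refine ⟨fun h => Subtype.ext (Finset.eq_of_subset_of_card_le h ?_), fun h => h ▸ le_rfl⟩
      rw [Set.powersetCard.card_eq, Set.powersetCard.card_eq]
    rw [LinearMap.BilinForm.flip_apply, wedgeForm_basis, Module.Basis.coord_apply,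
      Module.Basis.repr_self, Finsupp.single_apply]
    simp only [hr]
  rw [map_zero, Finsupp.zero_apply, ← Module.Basis.coord_apply, ← key]
  exact hx _

lemma polarSubspace_eq_orthogonal [CharP F 2] (C : Submodule F (⋀[F]^2 V)) :
    polarSubspace F V C = (wedgeForm b).orthogonal C := by
  ext y
  refine forall₂_congr fun x _ => ?_
  rw [mul_eq_wedgeForm_smul b, smul_eq_zero_iff_left (b.ExteriorAlgebra.ne_zero _)]

end WedgeForm

/-- An alternating form on a 3-dimensional space is zero or has a 1-dimensional radical. -/
lemma LinearMap.BilinForm.IsAlt.finrank_ker_eq_one_or_eq_zero {K W : Type*} [Field K]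
    [AddCommGroup W] [Module K W] {A : LinearMap.BilinForm K W} (hA : A.IsAlt)
    (hW : Module.finrank K W = 3) :
    Module.finrank K (LinearMap.ker A) = 1 ∨ A = 0 := by
  have : FiniteDimensional K W := Module.finite_of_finrank_eq_succ hW
  let c := Module.finBasisOfFinrankEq K W hW
  have self (x : W) : A x x = 0 := hA x
  have h10 : A (c 1) (c 0) = -A (c 0) (c 1) := (hA.neg_eq _ _).symm
  have h02 : A (c 0) (c 2) = -A (c 2) (c 0) := (hA.neg_eq _ _).symm
  have h21 : A (c 2) (c 1) = -A (c 1) (c 2) := (hA.neg_eq _ _).symm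
  set p := A (c 1) (c 2)
  set q := A (c 2) (c 0)
  set r := A (c 0) (c 1)
  have mem_ker (x y z : K) : x • c 0 + y • c 1 + z • c 2 ∈ LinearMap.ker A ↔
      z * q = y * r ∧ x * r = z * p ∧ y * p = x * q := by
    have : x • c 0 + y • c 1 + z • c 2 ∈ LinearMap.ker A ↔
        ∀ i, A (x • c 0 + y • c 1 + z • c 2) (c i) = 0 :=
      ⟨fun h i => by rw [LinearMap.mem_ker.mp h, LinearMap.zero_apply],
        fun h => LinearMap.mem_ker.mpr (c.ext h)⟩
    rw [this, Fin.forall_fin_succ, Fin.forall_fin_succ, Fin.forall_fin_succ]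
    simp [self, h10, h02, h21, p, q, r]
    grind
  by_cases h0 : p = 0 ∧ q = 0 ∧ r = 0
  · obtain ⟨hp, hq, hr⟩ := h0
    right
    refine c.ext fun i => c.ext fun j => ?_
    fin_cases i <;> fin_cases j <;> simp_all [p, q, r]
  · left
    have hv : p • c 0 + q • c 1 + r • c 2 ∈ LinearMap.ker A :=
      (mem_ker _ _ _).mpr ⟨mul_comm _ _, mul_comm _ _, mul_comm _ _⟩
    refine finrank_eq_one_iff'.mpr ⟨⟨_, hv⟩, fun h => h0 ?_, fun ⟨w, hw⟩ => ?_⟩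
    · have h' : p • c 0 + q • c 1 + r • c 2 = 0 := congrArg Subtype.val h
      have := Fintype.linearIndependent_iff.mp c.linearIndependent ![p, q, r]
        (by simpa [Fin.sum_univ_three] using h')
      exact ⟨this 0, this 1, this 2⟩
    · have hsum := c.sum_repr w
      rw [Fin.sum_univ_three] at hsum
      rw [← hsum, mem_ker] at hw
      obtain ⟨e1, e2, e3⟩ := hw
      generalize c.repr w 0 = x at *
      generalize c.repr w 1 = y at *
      generalize c.repr w 2 = z at *
      suffices ∃ d : K, d * p = x ∧ d * q = y ∧ d * r = z by
        obtain ⟨d, rfl, rfl, rfl⟩ := this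
        refine ⟨d, Subtype.ext ?_⟩
        simp [← hsum, smul_smul]
      have div_mul {a e f g : K} (hf : f ≠ 0) (h : a * e = g * f) : a / f * e = g :=
        (div_mul_eq_mul_div _ _ _).trans ((div_eq_iff hf).mpr h)
      by_cases hp : p = 0
      · by_cases hq : q = 0
        · have hr : r ≠ 0 := fun hr => h0 ⟨hp, hq, hr⟩
          exact ⟨z / r, div_mul hr e2.symm, div_mul hr e1, div_mul hr rfl⟩
        · exact ⟨y / q, div_mul hq e3, div_mul hq rfl, div_mul hq e1.symm⟩
      · exact ⟨x / p, div_mul hp rfl, div_mul hp e3.symm, div_mul hp e2⟩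

/-- In characteristic two, a plane `C` external to the Klein quadric meets its polar plane
`C^⊥` either in a single point or `C = C^⊥`. -/
theorem external_plane_meets_polar_char_two
    [FiniteDimensional F V] (hV : Module.finrank F V = 4)
    (hchar : ringChar F = 2)
    (C : Submodule F ↥(⋀[F]^2 V)) (hC : IsExternalPlane F V C) :
    Module.finrank F ↥(C ⊓ polarSubspace F V C) = 1 ∨ C = polarSubspace F V C := by
  have := ringChar.of_eq hchar
  let b := Module.finBasisOfFinrankEq F V hV
  have hrefl := (wedgeForm_isAlt b).isRefl
  have hrestrict : ((wedgeForm b).restrict C).IsAlt := fun x => wedgeForm_isAlt b x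
  rw [polarSubspace_eq_orthogonal b]
  refine (LinearMap.BilinForm.IsAlt.finrank_ker_eq_one_or_eq_zero (W := C) hrestrict
    hC.1).imp (fun h => ?_) (fun h => ?_)
  · suffices hmap : (LinearMap.ker ((wedgeForm b).restrict C)).map C.subtype =
        C ⊓ (wedgeForm b).orthogonal C by
      rw [← hmap, Submodule.finrank_map_subtype_eq, h]
    refine le_antisymm ?_ (LinearMap.BilinForm.inf_orthogonal_self_le_ker_restrict hrefl)
    rintro _ ⟨x, hx, rfl⟩
    exact ⟨x.2, fun y hy => hrefl _ _ (LinearMap.congr_fun hx ⟨y, hy⟩)⟩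
  · refine Submodule.eq_of_le_of_finrank_eq (fun y hy x hx => ?_) ?_
    · exact LinearMap.congr_fun₂ h ⟨x, hx⟩ ⟨y, hy⟩
    · rw [LinearMap.BilinForm.finrank_orthogonal (wedgeForm_nondegenerate b),
        exteriorPower.finrank_eq, hV, hC.1]
      rfl
end

section
/- Let C be a plane external to the Klein quadric. Let p, q, r be points of P(V) that are not collinear (i.e., p + q + r is 3-dimensional). Let M₁ be a line with r ≤ M₁ and C + γM₁ = C + γ(p + q), and let N₁ be a line with q ≤ N₁ and C^⊥ + γN₁ = C^⊥ + γ(p + r). Then M₁ ∩ N₁ ≠ 0, i.e., M₁ and N₁ have a common point. (This is the double space axiom: the parallelisms ∥_C and ∥_{C^⊥} turn P(V) into a projective double space.) -/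
open ExteriorAlgebra

variable (F : Type*) [Field F] (V : Type*) [AddCommGroup V] [Module F V]

variable {F V}

/-- Four linearly independent vectors of a 4-dimensional space have nonzero wedge product. -/
lemma wedge_four_ne_zero (hV : Module.finrank F V = 4) (v : Fin 4 → V)
    (hv : LinearIndependent F v) : ι F (v 0) * ι F (v 1) * (ι F (v 2) * ι F (v 3)) ≠ 0 := by
  intro h
  let b := basisOfLinearIndependentOfCardEqFinrank hv (by simp [hV])
  let f : ∀ i, V [⋀^Fin i]→ₗ[F] F := Pi.single 4 b.det
  have h₁ : ιMulti F 4 v = 0 := by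
    rw [← h, ιMulti_apply]
    simp [List.ofFn_succ, mul_assoc]
  have h₂ : liftAlternating (R := F) f (ιMulti F 4 v) = b.det v := by
    rw [liftAlternating_apply_ιMulti]
    simp [f]
  have hb : v = b := by simp [b]
  rw [h₁, map_zero, hb, b.det_self] at h₂
  exact zero_ne_one h₂

/-- A product of vectors in which the same vector occurs in the first and third place vanishes. -/
lemma ι_mul_ι_mul_ι_mul_ι_eq_zero_left (u v w : V) :
    ι F u * ι F v * (ι F u * ι F w) = 0 := by
  have h : ι F v * ι F u = -(ι F u * ι F v) := eq_neg_of_add_eq_zero_left (ι_add_mul_swap v u)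
  rw [mul_assoc, ← mul_assoc (ι F v), h, neg_mul, mul_neg, mul_assoc, ← mul_assoc, ι_sq_zero,
    zero_mul, neg_zero]

/-- A product of vectors in which the same vector occurs in the first and fourth place vanishes. -/
lemma ι_mul_ι_mul_ι_mul_ι_eq_zero_outer (u v w : V) :
    ι F u * ι F v * (ι F w * ι F u) = 0 := by
  have h : ι F w * ι F u = -(ι F u * ι F w) := eq_neg_of_add_eq_zero_left (ι_add_mul_swap w u)
  rw [h, mul_neg, ι_mul_ι_mul_ι_mul_ι_eq_zero_left, neg_zero]

/-- The Plücker point of the span of two vectors consists of the multiples of their wedge. -/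
lemma exists_smul_of_mem_plueckerPoint {u v : V} {x : ⋀[F]^2 V}
    (hx : x ∈ plueckerPoint F V (F ∙ u ⊔ F ∙ v)) :
    ∃ a : F, (x : ExteriorAlgebra F V) = a • (ι F u * ι F v) := by
  have huv : ι F v * ι F u = -(ι F u * ι F v) := eq_neg_of_add_eq_zero_left (ι_add_mul_swap v u)
  refine Submodule.span_induction ?_ ⟨0, by simp⟩ ?_ ?_ hx
  · rintro x ⟨y, hy, z, hz, hxyz⟩
    rw [← Submodule.span_union, Set.singleton_union, Submodule.mem_span_pair] at hy hz
    obtain ⟨a, b, rfl⟩ := hy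
    obtain ⟨c, d, rfl⟩ := hz
    refine ⟨a * d - b * c, ?_⟩
    rw [hxyz]
    simp only [map_add, map_smul, add_mul, mul_add, smul_mul_smul_comm, ι_sq_zero, huv]
    module
  · rintro x y - - ⟨a, ha⟩ ⟨b, hb⟩
    exact ⟨a + b, by rw [Submodule.coe_add, ha, hb, add_smul]⟩
  · rintro c x - ⟨a, ha⟩
    exact ⟨c * a, by rw [Submodule.coe_smul, ha, mul_smul]⟩

/-- If the line `M` is `C`-parallel to the line spanned by `u` and `v`, the wedge of two vectors
of `M` agrees with a multiple of `u ∧ v` modulo `C`. -/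
lemma exists_add_smul_of_sup_plueckerPoint_eq {C : Submodule F ↥(⋀[F]^2 V)} {M : Submodule F V}
    {u v y z : V} (h : C ⊔ plueckerPoint F V M = C ⊔ plueckerPoint F V (F ∙ u ⊔ F ∙ v))
    (hy : y ∈ M) (hz : z ∈ M) :
    ∃ c ∈ C, ∃ a : F, ι F y * ι F z = (c : ExteriorAlgebra F V) + a • (ι F u * ι F v) := by
  let x : ⋀[F]^2 V := ⟨ι F y * ι F z, by
    rw [exteriorPower, pow_two]
    exact Submodule.mul_mem_mul ⟨y, rfl⟩ ⟨z, rfl⟩⟩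
  have hx : x ∈ C ⊔ plueckerPoint F V (F ∙ u ⊔ F ∙ v) :=
    h ▸ Submodule.mem_sup_right (Submodule.subset_span ⟨y, hy, z, hz, rfl⟩)
  obtain ⟨c, hc, w, hw, hcw⟩ := Submodule.mem_sup.mp hx
  obtain ⟨a, ha⟩ := exists_smul_of_mem_plueckerPoint hw
  exact ⟨c, hc, a, by rw [← ha, ← Submodule.coe_add, hcw]⟩

/-- A nonzero vector of a 2-dimensional subspace extends to a linearly independent pair in it. -/
lemma exists_mem_linearIndependent_pair {M : Submodule F V} (hM : Module.finrank F M = 2) {u : V}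
    (hu : u ∈ M) (hu₀ : u ≠ 0) : ∃ w ∈ M, LinearIndependent F ![u, w] := by
  obtain ⟨w, hw⟩ := exists_linearIndependent_pair_of_one_lt_finrank (R := F) (M := M)
    (by omega) (x := ⟨u, hu⟩) (by simpa using hu₀)
  refine ⟨w, w.2, ?_⟩
  rw [LinearIndependent.pair_iff] at hw ⊢
  exact fun s t h => hw s t (Subtype.ext (by simpa using h))

variable (F V)

/-- The double space axiom: for non-collinear points `p, q, r`, the line `M₁` through `r`
that is `C`-parallel to `p + q` meets the line `N₁` through `q` that is `C^⊥`-parallel to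
`p + r`. -/
theorem double_space_axiom
    [FiniteDimensional F V] (hV : Module.finrank F V = 4)
    (C : Submodule F ↥(⋀[F]^2 V)) (hC : IsExternalPlane F V C)
    (p q r : Submodule F V)
    (hp : Module.finrank F p = 1) (hq : Module.finrank F q = 1)
    (hr : Module.finrank F r = 1)
    (hncol : Module.finrank F ↥(p ⊔ q ⊔ r) = 3)
    (M₁ : Submodule F V) (hM₁ : Module.finrank F M₁ = 2) (hrM₁ : r ≤ M₁)
    (hM₁par : C ⊔ plueckerPoint F V M₁ = C ⊔ plueckerPoint F V (p ⊔ q))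
    (N₁ : Submodule F V) (hN₁ : Module.finrank F N₁ = 2) (hqN₁ : q ≤ N₁)
    (hN₁par : polarSubspace F V C ⊔ plueckerPoint F V N₁ =
      polarSubspace F V C ⊔ plueckerPoint F V (p ⊔ r)) :
    M₁ ⊓ N₁ ≠ ⊥ := by
  have hspan (s : Submodule F V) (hs : Module.finrank F s = 1) : ∃ u : V, u ≠ 0 ∧ s = F ∙ u := by
    obtain ⟨u, hu, h⟩ := finrank_eq_one_iff'.mp hs
    refine ⟨u, by simpa using hu, le_antisymm (fun w hw => ?_) ?_⟩
    · obtain ⟨c, hc⟩ := h ⟨w, hw⟩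
      exact Submodule.mem_span_singleton.mpr ⟨c, congrArg Subtype.val hc⟩
    · simp
  obtain ⟨P, -, rfl⟩ := hspan p hp
  obtain ⟨Q, hQ, rfl⟩ := hspan q hq
  obtain ⟨R, hR, rfl⟩ := hspan r hr
  rw [Submodule.span_singleton_le_iff_mem] at hrM₁ hqN₁
  obtain ⟨S, hS, hRS⟩ := exists_mem_linearIndependent_pair hM₁ hrM₁ hR
  obtain ⟨T, hT, hQT⟩ := exists_mem_linearIndependent_pair hN₁ hqN₁ hQ
  obtain ⟨c, hc, a, hca⟩ := exists_add_smul_of_sup_plueckerPoint_eq hM₁par hrM₁ hS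
  obtain ⟨d, hd, b, hdb⟩ := exists_add_smul_of_sup_plueckerPoint_eq hN₁par hqN₁ hT
  have hcd : (c : ExteriorAlgebra F V) * d = 0 := hd c hc
  have hcPR : (c : ExteriorAlgebra F V) * (ι F P * ι F R) = 0 := by
    rw [eq_sub_of_add_eq hca.symm, sub_mul, ι_mul_ι_mul_ι_mul_ι_eq_zero_outer, smul_mul_assoc,
      ι_mul_ι_mul_ι_mul_ι_eq_zero_left, smul_zero, sub_zero]
  have hPQQT : ι F P * ι F Q * (ι F Q * ι F T) = 0 := by
    rw [mul_assoc, ← mul_assoc (ι F Q), ι_sq_zero, zero_mul, mul_zero]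
  have hwedge : ι F R * ι F S * (ι F Q * ι F T) = 0 := by
    rw [hca, add_mul, smul_mul_assoc, hPQQT, hdb, mul_add, mul_smul_comm, hcd, hcPR]
    simp
  intro hdisj
  refine wedge_four_ne_zero hV (Fin.append ![R, S] ![Q, T]) ?_ hwedge
  have hind := hRS.sum_type hQT ((disjoint_iff.mpr hdisj).mono
    (Submodule.span_le.mpr ?_) (Submodule.span_le.mpr ?_))
  · rw [← linearIndependent_equiv finSumFinEquiv]
    have hcomp : Fin.append ![R, S] ![Q, T] ∘ finSumFinEquiv = Sum.elim ![R, S] ![Q, T] := by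
      ext i
      rcases i with i | i <;> fin_cases i <;> rfl
    rwa [hcomp]
  · simp [Set.insert_subset_iff, hrM₁, hS]
  · simp [Set.insert_subset_iff, hqN₁, hT]
end

section
/- Let C = ker κ. For any two 2-dimensional F-subspaces M, N of H, there exists c ∈ H with c ≠ 0 and cM = N (i.e., N is the image of M under left multiplication by c) if and only if C + γM = C + γN as subspaces of ⋀²H. (Thus the canonical left Clifford parallelism of P(H) coincides with the parallelism ∥_C induced by the external plane C.) -/
open ExteriorAlgebra
open scoped Quaternion

variable (F : Type*) [Field F] (V : Type*) [AddCommGroup V] [Module F V]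

section LeftClifford

variable {K : Type*} [Field K] {c₁ c₂ : K}

local notation "H" => ℍ[K,c₁,c₂]

/-- The wedge of two vectors as an element of the second exterior power. -/
theorem exists_coe_eq_ι_mul_ι {W : Type*} [AddCommGroup W] [Module K W] (u v : W) :
    ∃ x : ⋀[K]^2 W, (x : ExteriorAlgebra K W) = ι K u * ι K v :=
  ⟨exteriorPower.ιMulti K 2 ![u, v], by simp [ExteriorAlgebra.ιMulti_apply]⟩

theorem exists_star_mul_self_eq_smul_one (a : H) : ∃ r : K, star a * a = r • (1 : H) :=
  ⟨(star a * a).re, by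
    rw [← QuaternionAlgebra.coe_mul_eq_smul, mul_one]
    exact QuaternionAlgebra.star_mul_eq_coe a⟩

theorem exists_ne_zero_star_mul_self_eq_smul_one {u : H} (hu : IsUnit u) :
    ∃ r : K, r ≠ 0 ∧ star u * u = r • (1 : H) := by
  obtain ⟨r, hr⟩ := exists_star_mul_self_eq_smul_one u
  refine ⟨r, ?_, hr⟩
  rintro rfl
  exact (hu.star.mul hu).ne_zero (by rw [hr, zero_smul])

theorem one_mem_map_mulLeft_star {u : H} (hu : IsUnit u) {M : Submodule K H} (huM : u ∈ M) :
    (1 : H) ∈ M.map (LinearMap.mulLeft K (star u)) := by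
  obtain ⟨r, hr, h⟩ := exists_ne_zero_star_mul_self_eq_smul_one hu
  refine ⟨r⁻¹ • u, M.smul_mem _ huM, ?_⟩
  rw [LinearMap.mulLeft_apply, mul_smul_comm, h, inv_smul_smul₀ hr]

theorem exists_star_eq_smul_one_sub (a : H) : ∃ r : K, star a = r • (1 : H) - a :=
  ⟨2 * a.re + 0 * a.imI, by
    rw [← QuaternionAlgebra.coe_mul_eq_smul, mul_one]
    exact QuaternionAlgebra.star_eq_two_re_sub a⟩

theorem star_mul_mem_map_mulLeft_star {u v a b : H} (hu : IsUnit u)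
    (ha : a ∈ Submodule.span K {u, v}) (hb : b ∈ Submodule.span K {u, v}) :
    star a * b ∈ (Submodule.span K {u, v}).map (LinearMap.mulLeft K (star u)) := by
  set L := (Submodule.span K {u, v}).map (LinearMap.mulLeft K (star u))
  have h1 : (1 : H) ∈ L :=
    one_mem_map_mulLeft_star hu (Submodule.subset_span (Set.mem_insert _ _))
  have huv : star u * v ∈ L := ⟨v, Submodule.subset_span (by simp), rfl⟩
  obtain ⟨r, hr⟩ := exists_star_mul_self_eq_smul_one u
  obtain ⟨s, hs⟩ := exists_star_mul_self_eq_smul_one v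
  have huu : star u * u ∈ L := hr ▸ L.smul_mem r h1
  have hvv : star v * v ∈ L := hs ▸ L.smul_mem s h1
  have hvu : star v * u ∈ L := by
    obtain ⟨t, ht⟩ := exists_star_eq_smul_one_sub (star u * v)
    rw [star_mul, star_star] at ht
    exact ht ▸ L.sub_mem (L.smul_mem t h1) huv
  obtain ⟨p, q, rfl⟩ := Submodule.mem_span_pair.1 ha
  obtain ⟨p', q', rfl⟩ := Submodule.mem_span_pair.1 hb
  simp only [star_add, QuaternionAlgebra.star_smul, add_mul, mul_add, smul_mul_assoc,
    mul_smul_comm, smul_add]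
  exact L.add_mem (L.add_mem (L.smul_mem _ (L.smul_mem _ huu)) (L.smul_mem _ (L.smul_mem _ hvu)))
    (L.add_mem (L.smul_mem _ (L.smul_mem _ huv)) (L.smul_mem _ (L.smul_mem _ hvv)))

/-- The preimage in `H` of `κ(γM)` is the left translate of `M` by `star u`, for any line `M`
spanned by `u` and `v`. -/
theorem comap_mkQ_map_plueckerPoint
    (κ : ↥(⋀[K]^2 H) →ₗ[K] (H ⧸ Submodule.span K {(1 : H)}))
    (hκ : ∀ (g h : H) (x : ⋀[K]^2 H), (x : ExteriorAlgebra K H) = ι K g * ι K h →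
      κ x = Submodule.Quotient.mk (star g * h))
    {u v : H} (hu : IsUnit u) :
    ((plueckerPoint K H (Submodule.span K {u, v})).map κ).comap
        (Submodule.span K {(1 : H)}).mkQ =
      (Submodule.span K {u, v}).map (LinearMap.mulLeft K (star u)) := by
  have huM : u ∈ Submodule.span K {u, v} := Submodule.subset_span (Set.mem_insert _ _)
  apply le_antisymm
  · have h : (plueckerPoint K H (Submodule.span K {u, v})).map κ ≤
        ((Submodule.span K {u, v}).map (LinearMap.mulLeft K (star u))).map
          (Submodule.span K {(1 : H)}).mkQ := by
      rw [Submodule.map_le_iff_le_comap]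
      refine Submodule.span_le.2 ?_
      rintro x ⟨a, ha, b, hb, hx⟩
      exact ⟨star a * b, star_mul_mem_map_mulLeft_star hu ha hb, (hκ a b x hx).symm⟩
    refine (Submodule.comap_mono h).trans ?_
    rw [Submodule.comap_map_mkQ]
    refine sup_le ?_ le_rfl
    rw [Submodule.span_singleton_le_iff_mem]
    exact one_mem_map_mulLeft_star hu huM
  · rintro _ ⟨b, hb, rfl⟩
    obtain ⟨x, hx⟩ := exists_coe_eq_ι_mul_ι (K := K) u b
    exact ⟨x, Submodule.subset_span ⟨u, huM, b, hb, hx⟩, hκ u b x hx⟩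

theorem exists_eq_span_pair_of_finrank_eq_two {W : Type*} [AddCommGroup W] [Module K W]
    {M : Submodule K W} (hM : Module.finrank K M = 2) :
    ∃ u v : W, u ≠ 0 ∧ M = Submodule.span K {u, v} := by
  have : Module.Finite K M := Module.finite_of_finrank_eq_succ hM
  let b := Module.finBasisOfFinrankEq K M hM
  refine ⟨b 0, b 1, by simpa using b.ne_zero 0, ?_⟩
  have h := congrArg (Submodule.map M.subtype) b.span_eq
  rw [Submodule.map_span, Submodule.map_subtype_top, ← Set.range_comp] at h
  refine h.symm.trans (congrArg _ ?_)
  ext x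
  simp [Fin.exists_fin_two, eq_comm]

theorem ker_sup_eq_ker_sup_iff {R W W' : Type*} [Ring R] [AddCommGroup W] [Module R W]
    [AddCommGroup W'] [Module R W'] (f : W →ₗ[R] W') (p q : Submodule R W) :
    LinearMap.ker f ⊔ p = LinearMap.ker f ⊔ q ↔ p.map f = q.map f := by
  rw [sup_comm, sup_comm _ q, ← Submodule.comap_map_eq, ← Submodule.comap_map_eq]
  refine ⟨fun h => ?_, fun h => by rw [h]⟩
  simpa [Submodule.map_comap_eq, inf_eq_right.2 LinearMap.map_le_range] using
    congrArg (Submodule.map f) h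

theorem map_mulLeft_map_mulLeft {R A : Type*} [CommSemiring R] [Semiring A] [Algebra R A]
    (a b : A) (M : Submodule R A) :
    (M.map (LinearMap.mulLeft R b)).map (LinearMap.mulLeft R a) =
      M.map (LinearMap.mulLeft R (a * b)) := by
  rw [LinearMap.mulLeft_mul, Submodule.map_comp]

end LeftClifford

/-- The canonical left Clifford parallelism of `P(H)` coincides with the parallelism
induced by the external plane `C = ker κ`: two lines `M, N` of `P(H)` satisfy `cM = N`
for some `c ≠ 0` iff `C + γM = C + γN`. -/
theorem left_clifford_eq_kerKappa_parallelism (c₁ c₂ : F)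
    (hdiv : ∀ a : ℍ[F,c₁,c₂], a ≠ 0 → IsUnit a)
    (κ : ↥(⋀[F]^2 ℍ[F,c₁,c₂]) →ₗ[F]
      (ℍ[F,c₁,c₂] ⧸ Submodule.span F {(1 : ℍ[F,c₁,c₂])}))
    (hκ : ∀ (g h : ℍ[F,c₁,c₂]) (x : ⋀[F]^2 ℍ[F,c₁,c₂]),
      (x : ExteriorAlgebra F ℍ[F,c₁,c₂]) = ι F g * ι F h →
        κ x = Submodule.Quotient.mk (star g * h)) :
    ∀ M N : Submodule F ℍ[F,c₁,c₂],
      Module.finrank F M = 2 → Module.finrank F N = 2 →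
      ((∃ c : ℍ[F,c₁,c₂], c ≠ 0 ∧ Submodule.map (LinearMap.mulLeft F c) M = N) ↔
        LinearMap.ker κ ⊔ plueckerPoint F ℍ[F,c₁,c₂] M =
          LinearMap.ker κ ⊔ plueckerPoint F ℍ[F,c₁,c₂] N) := by
  intro M N hM hN
  obtain ⟨u, v, hu, rfl⟩ := exists_eq_span_pair_of_finrank_eq_two hM
  rw [ker_sup_eq_ker_sup_iff,
    ← (Submodule.comap_injective_of_surjective (Submodule.mkQ_surjective _)).eq_iff,
    comap_mkQ_map_plueckerPoint κ hκ (hdiv u hu)]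
  constructor
  · rintro ⟨c, hc, rfl⟩
    obtain ⟨r, hr, h⟩ := exists_ne_zero_star_mul_self_eq_smul_one (hdiv c hc)
    have hspan : (Submodule.span F {u, v}).map (LinearMap.mulLeft F c) =
        Submodule.span F {c * u, c * v} := by
      simp [Submodule.map_span, Set.image_pair]
    rw [hspan, comap_mkQ_map_plueckerPoint κ hκ ((hdiv c hc).mul (hdiv u hu)), ← hspan,
      map_mulLeft_map_mulLeft]
    have hmul : LinearMap.mulLeft F (star (c * u) * c) = r • LinearMap.mulLeft F (star u) := by
      ext1 x
      rw [star_mul, mul_assoc, h, LinearMap.smul_apply, LinearMap.mulLeft_apply,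
        LinearMap.mulLeft_apply, mul_smul_comm, mul_one, smul_mul_assoc]
    rw [hmul, Submodule.map_smul _ _ _ hr]
  · obtain ⟨w, z, hw, rfl⟩ := exists_eq_span_pair_of_finrank_eq_two hN
    rw [comap_mkQ_map_plueckerPoint κ hκ (hdiv w hw)]
    intro h
    obtain ⟨s, hs⟩ := (hdiv w hw).star
    refine ⟨↑s⁻¹ * star u, (s⁻¹.isUnit.mul (hdiv u hu).star).ne_zero, ?_⟩
    rw [← map_mulLeft_map_mulLeft, h, map_mulLeft_map_mulLeft, ← hs, Units.inv_mul,
      LinearMap.mulLeft_one, Submodule.map_id]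
end

section
/- Let C' = ker κ'. For any two 2-dimensional F-subspaces M, N of H, there exists c ∈ H with c ≠ 0 and Mc = N (i.e., N is the image of M under right multiplication by c) if and only if C' + γM = C' + γN as subspaces of ⋀²H. (Thus the canonical right Clifford parallelism of P(H) coincides with the parallelism ∥_{C'} induced by the external plane C'.) -/
open ExteriorAlgebra
open scoped Quaternion

variable (F : Type*) [Field F] (V : Type*) [AddCommGroup V] [Module F V]

namespace QuaternionAlgebra

variable {F} {c₁ c₂ c₃ : F}

/-- The span of all products `a * star b` with `a, b ∈ M`. -/
def mulStarSpan (M : Submodule F ℍ[F,c₁,c₂,c₃]) : Submodule F ℍ[F,c₁,c₂,c₃] :=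
  Submodule.span F {x | ∃ a ∈ M, ∃ b ∈ M, x = a * star b}

theorem exists_mul_star_eq_coe (hdiv : ∀ a : ℍ[F,c₁,c₂,c₃], a ≠ 0 → IsUnit a)
    {a : ℍ[F,c₁,c₂,c₃]} (ha : a ≠ 0) : ∃ r : F, r ≠ 0 ∧ a * star a = r := by
  refine ⟨_, fun h => ?_, a.mul_star_eq_coe⟩
  have h0 : a * star a = 0 := by rw [mul_star_eq_coe, h, coe_zero]
  exact ha (star_eq_zero.mp ((hdiv a ha).mul_right_eq_zero.mp h0))

theorem span_one_le_mulStarSpan (hdiv : ∀ a : ℍ[F,c₁,c₂,c₃], a ≠ 0 → IsUnit a)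
    {M : Submodule F ℍ[F,c₁,c₂,c₃]} (hM : M ≠ ⊥) :
    Submodule.span F {(1 : ℍ[F,c₁,c₂,c₃])} ≤ mulStarSpan M := by
  obtain ⟨u, hu, hu0⟩ := M.ne_bot_iff.mp hM
  obtain ⟨r, hr, hur⟩ := exists_mul_star_eq_coe hdiv hu0
  rw [Submodule.span_singleton_le_iff_mem]
  have h1 : (1 : ℍ[F,c₁,c₂,c₃]) = r⁻¹ • (u * star u) := by
    rw [hur, smul_coe, inv_mul_cancel₀ hr, coe_one]
  rw [h1]
  exact Submodule.smul_mem _ _ (Submodule.subset_span ⟨u, hu, u, hu, rfl⟩)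

theorem mulStarSpan_map_mulRight (hdiv : ∀ a : ℍ[F,c₁,c₂,c₃], a ≠ 0 → IsUnit a)
    (M : Submodule F ℍ[F,c₁,c₂,c₃]) {c : ℍ[F,c₁,c₂,c₃]} (hc : c ≠ 0) :
    mulStarSpan (M.map (LinearMap.mulRight F c)) = mulStarSpan M := by
  obtain ⟨r, hr, hcr⟩ := exists_mul_star_eq_coe hdiv hc
  have key (a b : ℍ[F,c₁,c₂,c₃]) : a * c * star (b * c) = r • (a * star b) := by
    rw [star_mul, mul_assoc, ← mul_assoc c, hcr, ← mul_assoc, ← coe_commutes, mul_assoc,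
      coe_mul_eq_smul]
  apply le_antisymm <;> refine Submodule.span_le.mpr ?_
  · rintro _ ⟨_, ⟨a, ha, rfl⟩, _, ⟨b, hb, rfl⟩, rfl⟩
    rw [LinearMap.mulRight_apply, LinearMap.mulRight_apply, key]
    exact Submodule.smul_mem _ _ (Submodule.subset_span ⟨a, ha, b, hb, rfl⟩)
  · rintro _ ⟨a, ha, b, hb, rfl⟩
    have h : a * star b = r⁻¹ • (a * c * star (b * c)) := by
      rw [key, smul_smul, inv_mul_cancel₀ hr, one_smul]
    rw [h]
    exact Submodule.smul_mem _ _ (Submodule.subset_span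
      ⟨_, Submodule.mem_map_of_mem ha, _, Submodule.mem_map_of_mem hb, rfl⟩)

theorem mulStarSpan_eq_map_mulRight (hdiv : ∀ a : ℍ[F,c₁,c₂,c₃], a ≠ 0 → IsUnit a)
    {M : Submodule F ℍ[F,c₁,c₂,c₃]} (hM : Module.finrank F M = 2) {u : ℍ[F,c₁,c₂,c₃]}
    (hu : u ∈ M) (hu0 : u ≠ 0) :
    mulStarSpan M = M.map (LinearMap.mulRight F (star u)) := by
  obtain ⟨r, hr, hur⟩ := exists_mul_star_eq_coe hdiv hu0
  have hcoe (s : F) : (s : ℍ[F,c₁,c₂,c₃]) ∈ M.map (LinearMap.mulRight F (star u)) := by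
    refine ⟨(s * r⁻¹) • u, M.smul_mem _ hu, ?_⟩
    rw [LinearMap.mulRight_apply, smul_mul_assoc, hur, smul_coe, inv_mul_cancel_right₀ hr]
  have hmem {a : ℍ[F,c₁,c₂,c₃]} (ha : a ∈ M) :
      a * star u ∈ M.map (LinearMap.mulRight F (star u)) := ⟨a, ha, rfl⟩
  have hmem' {a : ℍ[F,c₁,c₂,c₃]} (ha : a ∈ M) :
      u * star a ∈ M.map (LinearMap.mulRight F (star u)) := by
    have h := star_eq_two_re_sub (a * star u)
    rw [star_mul, star_star] at h
    rw [h]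
    exact Submodule.sub_mem _ (hcoe _) (hmem ha)
  obtain ⟨v, hv⟩ : ∃ v : M, ∀ w : M, ∃ x y : F, x • u + y • (v : ℍ[F,c₁,c₂,c₃]) = w := by
    obtain ⟨v, hv⟩ := exists_linearIndependent_pair_of_one_lt_finrank
      (R := F) (by rw [hM]; norm_num) (x := (⟨u, hu⟩ : M)) (by simpa using hu0)
    refine ⟨v, fun w => ?_⟩
    have hspan := hv.span_eq_top_of_card_eq_finrank (by simp [hM])
    rw [Matrix.range_cons_cons_empty] at hspan
    obtain ⟨x, y, h⟩ := Submodule.mem_span_pair.mp (hspan ▸ Submodule.mem_top : w ∈ _)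
    exact ⟨x, y, congrArg Subtype.val h⟩
  apply le_antisymm
  · refine Submodule.span_le.mpr ?_
    rintro _ ⟨a, ha, b, hb, rfl⟩
    obtain ⟨x, y, hxy⟩ := hv ⟨b, hb⟩
    obtain ⟨x', y', hxy'⟩ := hv ⟨a, ha⟩
    obtain rfl : x • u + y • (v : ℍ[F,c₁,c₂,c₃]) = b := hxy
    obtain rfl : x' • u + y' • (v : ℍ[F,c₁,c₂,c₃]) = a := hxy'
    rw [star_add, star_smul, star_smul, mul_add, mul_smul_comm, mul_smul_comm, add_mul _ _ (star v.1),
      smul_mul_assoc x' u (star v.1), smul_mul_assoc, mul_star_eq_coe v.1]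
    exact Submodule.add_mem _ (Submodule.smul_mem _ _ (hmem ha)) (Submodule.smul_mem _ _
      (Submodule.add_mem _ (Submodule.smul_mem _ _ (hmem' v.2)) (Submodule.smul_mem _ _ (hcoe _))))
  · rintro _ ⟨a, ha, rfl⟩
    exact Submodule.subset_span ⟨a, ha, u, hu, rfl⟩

theorem exists_map_mulRight_eq_iff_mulStarSpan_eq
    (hdiv : ∀ a : ℍ[F,c₁,c₂,c₃], a ≠ 0 → IsUnit a) {M N : Submodule F ℍ[F,c₁,c₂,c₃]}
    (hM : Module.finrank F M = 2) (hN : Module.finrank F N = 2) :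
    (∃ c : ℍ[F,c₁,c₂,c₃], c ≠ 0 ∧ M.map (LinearMap.mulRight F c) = N) ↔
      mulStarSpan M = mulStarSpan N := by
  constructor
  · rintro ⟨c, hc, rfl⟩
    exact (mulStarSpan_map_mulRight hdiv M hc).symm
  · intro h
    obtain ⟨u, hu, hu0⟩ := M.ne_bot_iff.mp (by rintro rfl; simp at hM)
    obtain ⟨v, hv, hv0⟩ := N.ne_bot_iff.mp (by rintro rfl; simp at hN)
    obtain ⟨a, ha⟩ := hdiv (star u) (star_ne_zero.mpr hu0)
    obtain ⟨b, hb⟩ := hdiv (star v) (star_ne_zero.mpr hv0)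
    have : Nontrivial ℍ[F,c₁,c₂,c₃] := ⟨u, 0, hu0⟩
    rw [mulStarSpan_eq_map_mulRight hdiv hM hu hu0, mulStarSpan_eq_map_mulRight hdiv hN hv hv0,
      ← ha, ← hb] at h
    refine ⟨_, (a * b⁻¹).ne_zero, ?_⟩
    rw [Units.val_mul, LinearMap.mulRight_mul, Submodule.map_comp, h, ← Submodule.map_comp,
      ← LinearMap.mulRight_mul, Units.mul_inv, LinearMap.mulRight_one, Submodule.map_id]

theorem map_plueckerPoint_eq_map_mkQ
    (κ' : ↥(⋀[F]^2 ℍ[F,c₁,c₂,c₃]) →ₗ[F]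
      (ℍ[F,c₁,c₂,c₃] ⧸ Submodule.span F {(1 : ℍ[F,c₁,c₂,c₃])}))
    (hκ' : ∀ (g h : ℍ[F,c₁,c₂,c₃]) (x : ⋀[F]^2 ℍ[F,c₁,c₂,c₃]),
      (x : ExteriorAlgebra F ℍ[F,c₁,c₂,c₃]) = ι F g * ι F h →
        κ' x = Submodule.Quotient.mk (g * star h))
    (M : Submodule F ℍ[F,c₁,c₂,c₃]) :
    (plueckerPoint F ℍ[F,c₁,c₂,c₃] M).map κ' =
      (mulStarSpan M).map (Submodule.span F {(1 : ℍ[F,c₁,c₂,c₃])}).mkQ := by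
  rw [plueckerPoint, mulStarSpan, Submodule.map_span, Submodule.map_span]
  congr 1
  ext z
  constructor
  · rintro ⟨x, ⟨a, ha, b, hb, hx⟩, rfl⟩
    exact ⟨_, ⟨a, ha, b, hb, rfl⟩, (hκ' a b x hx).symm⟩
  · rintro ⟨_, ⟨a, ha, b, hb, rfl⟩, rfl⟩
    have hx : (exteriorPower.ιMulti F 2 ![a, b] : ExteriorAlgebra F ℍ[F,c₁,c₂,c₃]) =
        ι F a * ι F b := by
      simp [ιMulti_apply]
    exact ⟨_, ⟨a, ha, b, hb, hx⟩, hκ' a b _ hx⟩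

theorem ker_sup_plueckerPoint_eq_iff (hdiv : ∀ a : ℍ[F,c₁,c₂,c₃], a ≠ 0 → IsUnit a)
    (κ' : ↥(⋀[F]^2 ℍ[F,c₁,c₂,c₃]) →ₗ[F]
      (ℍ[F,c₁,c₂,c₃] ⧸ Submodule.span F {(1 : ℍ[F,c₁,c₂,c₃])}))
    (hκ' : ∀ (g h : ℍ[F,c₁,c₂,c₃]) (x : ⋀[F]^2 ℍ[F,c₁,c₂,c₃]),
      (x : ExteriorAlgebra F ℍ[F,c₁,c₂,c₃]) = ι F g * ι F h →
        κ' x = Submodule.Quotient.mk (g * star h))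
    {M N : Submodule F ℍ[F,c₁,c₂,c₃]} (hM : M ≠ ⊥) (hN : N ≠ ⊥) :
    LinearMap.ker κ' ⊔ plueckerPoint F ℍ[F,c₁,c₂,c₃] M =
        LinearMap.ker κ' ⊔ plueckerPoint F ℍ[F,c₁,c₂,c₃] N ↔
      mulStarSpan M = mulStarSpan N := by
  have hmap (S : Submodule F ↥(⋀[F]^2 ℍ[F,c₁,c₂,c₃])) :
      (LinearMap.ker κ' ⊔ S).map κ' = S.map κ' := by
    rw [Submodule.map_sup, LinearMap.le_ker_iff_map.mp le_rfl, bot_sup_eq]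
  constructor
  · intro h
    have h' := congrArg (Submodule.map κ') h
    rw [hmap, hmap, map_plueckerPoint_eq_map_mkQ κ' hκ', map_plueckerPoint_eq_map_mkQ κ' hκ'] at h'
    have h'' := congrArg (Submodule.comap (Submodule.span F {(1 : ℍ[F,c₁,c₂,c₃])}).mkQ) h'
    rwa [Submodule.comap_map_mkQ, Submodule.comap_map_mkQ,
      sup_of_le_right (span_one_le_mulStarSpan hdiv hM),
      sup_of_le_right (span_one_le_mulStarSpan hdiv hN)] at h''
  · intro h
    rw [sup_comm, ← Submodule.comap_map_eq, map_plueckerPoint_eq_map_mkQ κ' hκ', h,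
      ← map_plueckerPoint_eq_map_mkQ κ' hκ', Submodule.comap_map_eq, sup_comm]

end QuaternionAlgebra

/-- The canonical right Clifford parallelism of `P(H)` coincides with the parallelism
induced by the external plane `C' = ker κ'`: two lines `M, N` of `P(H)` satisfy `Mc = N`
for some `c ≠ 0` iff `C' + γM = C' + γN`. -/
theorem right_clifford_eq_kerKappa'_parallelism (c₁ c₂ : F)
    (hdiv : ∀ a : ℍ[F,c₁,c₂], a ≠ 0 → IsUnit a)
    (κ' : ↥(⋀[F]^2 ℍ[F,c₁,c₂]) →ₗ[F]
      (ℍ[F,c₁,c₂] ⧸ Submodule.span F {(1 : ℍ[F,c₁,c₂])}))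
    (hκ' : ∀ (g h : ℍ[F,c₁,c₂]) (x : ⋀[F]^2 ℍ[F,c₁,c₂]),
      (x : ExteriorAlgebra F ℍ[F,c₁,c₂]) = ι F g * ι F h →
        κ' x = Submodule.Quotient.mk (g * star h)) :
    ∀ M N : Submodule F ℍ[F,c₁,c₂],
      Module.finrank F M = 2 → Module.finrank F N = 2 →
      ((∃ c : ℍ[F,c₁,c₂], c ≠ 0 ∧ Submodule.map (LinearMap.mulRight F c) M = N) ↔
        LinearMap.ker κ' ⊔ plueckerPoint F ℍ[F,c₁,c₂] M =
          LinearMap.ker κ' ⊔ plueckerPoint F ℍ[F,c₁,c₂] N) := by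
  intro M N hM hN
  rw [QuaternionAlgebra.exists_map_mulRight_eq_iff_mulStarSpan_eq hdiv hM hN,
    QuaternionAlgebra.ker_sup_plueckerPoint_eq_iff hdiv κ' hκ'
      (by rintro rfl; simp at hM) (by rintro rfl; simp at hN)]
end

section
/- The planes C = ker κ and C' = ker κ' are mutually polar with respect to the Klein quadric: an element y ∈ ⋀²H lies in ker κ' if and only if x ∧ y = 0 (computed in the exterior algebra of H, landing in ⋀⁴H) for every x ∈ ker κ. -/
open ExteriorAlgebra
open scoped Quaternion

variable (F : Type*) [Field F] (V : Type*) [AddCommGroup V] [Module F V]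

section KleinQuadric

variable {F V}

/-- The wedge `u ∧ v` as an element of the second exterior power. -/
noncomputable def wedge (u v : V) : ⋀[F]^2 V := exteriorPower.ιMulti F 2 ![u, v]

theorem coe_wedge (u v : V) : ((wedge u v : ⋀[F]^2 V) : ExteriorAlgebra F V) = ι F u * ι F v := by
  simp [wedge, ιMulti_apply]

theorem wedge_add_right (u v w : V) :
    (wedge u (v + w) : ⋀[F]^2 V) = wedge u v + wedge u w :=
  Subtype.ext (by simp [coe_wedge, mul_add])

theorem wedge_smul_right (a : F) (u v : V) :
    (wedge u (a • v) : ⋀[F]^2 V) = a • wedge u v :=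
  Subtype.ext (by simp [coe_wedge])

theorem wedge_eq_zero_of_mem_span {u v : V} (h : v ∈ Submodule.span F {u}) :
    (wedge u v : ⋀[F]^2 V) = 0 := by
  obtain ⟨a, rfl⟩ := Submodule.mem_span_singleton.1 h
  exact Subtype.ext (by simp [coe_wedge])

theorem coe_wedge_mul_coe_wedge (u v w z : V) :
    ((wedge u v : ⋀[F]^2 V) : ExteriorAlgebra F V) * (wedge w z : ⋀[F]^2 V) =
      ιMulti F 4 ![u, v, w, z] := by
  simp [coe_wedge, ιMulti_apply, mul_assoc]

theorem ιMulti_eq_det_smul {n : ℕ} (e : Module.Basis (Fin n) F V) (v : Fin n → V) :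
    ιMulti F n v = e.det v • ιMulti F n e := by
  have h : ιMulti F n = (LinearMap.toSpanSingleton F _ (ιMulti F n e)).compAlternatingMap e.det :=
    e.ext_alternating fun w hw => by
      obtain ⟨σ, rfl⟩ : ∃ σ : Equiv.Perm (Fin n), ⇑σ = w :=
        ⟨Equiv.ofBijective w (Finite.injective_iff_bijective.1 hw), rfl⟩
      have hσ (f : V [⋀^Fin n]→ₗ[F] ExteriorAlgebra F V) :
          f (fun i => e (σ i)) = Equiv.Perm.sign σ • f e := f.map_perm e σ
      rw [hσ, hσ]
      simp [e.det_self]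
  exact congrArg (fun f => f v) h

theorem coe_wedge_mul_coe_wedge_eq_det_smul (e : Module.Basis (Fin 4) F V) (u v w z : V) :
    ((wedge u v : ⋀[F]^2 V) : ExteriorAlgebra F V) * (wedge w z : ⋀[F]^2 V) =
      e.det ![u, v, w, z] • ιMulti F 4 e := by
  rw [coe_wedge_mul_coe_wedge, ιMulti_eq_det_smul e]

theorem det_eq_zero_of_ιMulti_eq_zero {n : ℕ} (e : Module.Basis (Fin n) F V) {v : Fin n → V}
    (h : ιMulti F n v = 0) : e.det v = 0 := by
  have hv : exteriorPower.ιMulti F n v = 0 := Subtype.ext h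
  rw [← exteriorPower.alternatingMapLinearEquiv_apply_ιMulti e.det v, hv, map_zero]

/-- The span of the differences `g ∧ h - p ∧ m g h`. -/
def wedgeRelations (p : V) (m : V → V → V) : Submodule F (⋀[F]^2 V) :=
  Submodule.span F (Set.range fun q : V × V => wedge q.1 q.2 - wedge p (m q.1 q.2))

theorem wedge_sub_mem_wedgeRelations (p : V) (m : V → V → V) (g h : V) :
    (wedge g h - wedge p (m g h) : ⋀[F]^2 V) ∈ wedgeRelations p m :=
  Submodule.subset_span ⟨(g, h), rfl⟩

theorem exists_sub_wedge_mem_wedgeRelations (p : V) (m : V → V → V) (x : ⋀[F]^2 V) :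
    ∃ v, x - wedge p v ∈ wedgeRelations p m := by
  have hx : x ∈ Submodule.span F (Set.range (exteriorPower.ιMulti F 2 (M := V))) := by
    rw [exteriorPower.ιMulti_span]; trivial
  induction hx using Submodule.span_induction with
  | mem x hx =>
    obtain ⟨w, rfl⟩ := hx
    refine ⟨m (w 0) (w 1), ?_⟩
    have hw : exteriorPower.ιMulti F 2 w = wedge (w 0) (w 1) := by
      rw [wedge]; congr 1; ext i; fin_cases i <;> rfl
    rw [hw]
    exact wedge_sub_mem_wedgeRelations p m _ _
  | zero => exact ⟨0, by simp [wedge_eq_zero_of_mem_span]⟩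
  | add x y _ _ hx hy =>
    obtain ⟨v, hv⟩ := hx
    obtain ⟨w, hw⟩ := hy
    refine ⟨v + w, ?_⟩
    rw [wedge_add_right, add_sub_add_comm]
    exact add_mem hv hw
  | smul a x _ hx =>
    obtain ⟨v, hv⟩ := hx
    refine ⟨a • v, ?_⟩
    rw [wedge_smul_right, ← smul_sub]
    exact Submodule.smul_mem _ a hv

theorem ker_eq_wedgeRelations {W : Type*} [AddCommGroup W] [Module F W] {p : V} {m : V → V → V}
    (f : ⋀[F]^2 V →ₗ[F] W) (hm : ∀ g h, f (wedge g h) = f (wedge p (m g h)))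
    (hp : ∀ v, f (wedge p v) = 0 → v ∈ Submodule.span F {p}) :
    LinearMap.ker f = wedgeRelations p m := by
  have hle : wedgeRelations p m ≤ LinearMap.ker f := by
    rw [wedgeRelations, Submodule.span_le]
    rintro _ ⟨q, rfl⟩
    simp [hm q.1 q.2]
  refine le_antisymm (fun x hx => ?_) hle
  obtain ⟨v, hv⟩ := exists_sub_wedge_mem_wedgeRelations p m x
  have hfv : f (wedge p v) = 0 := by
    have := hle hv
    rw [LinearMap.mem_ker, map_sub, LinearMap.mem_ker.1 hx, zero_sub, neg_eq_zero] at this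
    exact this
  rwa [wedge_eq_zero_of_mem_span (hp v hfv), sub_zero] at hv

end KleinQuadric

namespace QuaternionAlgebra

variable {F}
variable {c₁ c₂ c₃ : F}

theorem mem_span_one_iff {v : ℍ[F,c₁,c₂,c₃]} :
    v ∈ Submodule.span F {(1 : ℍ[F,c₁,c₂,c₃])} ↔ v.imI = 0 ∧ v.imJ = 0 ∧ v.imK = 0 := by
  rw [Submodule.mem_span_singleton]
  constructor
  · rintro ⟨a, rfl⟩
    simp
  · rintro ⟨hi, hj, hk⟩
    exact ⟨v.re, by ext <;> simp [hi, hj, hk]⟩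

theorem star_mem_span_one_iff {v : ℍ[F,c₁,c₂,c₃]} :
    star v ∈ Submodule.span F {(1 : ℍ[F,c₁,c₂,c₃])} ↔
      v ∈ Submodule.span F {(1 : ℍ[F,c₁,c₂,c₃])} := by
  simp [mem_span_one_iff]

theorem det_basisOneIJK (u v w z : ℍ[F,c₁,c₂,c₃]) :
    (basisOneIJK c₁ c₂ c₃).det ![u, v, w, z] =
      Matrix.det !![u.re, u.imI, u.imJ, u.imK; v.re, v.imI, v.imJ, v.imK;
        w.re, w.imI, w.imJ, w.imK; z.re, z.imI, z.imJ, z.imK] := by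
  rw [Module.Basis.det_apply, ← Matrix.det_transpose]
  congr 1
  ext i j
  fin_cases i <;> fin_cases j <;> simp [Module.Basis.toMatrix_apply]

theorem det_star_mul_add_det_mul_star (g h g' h' : ℍ[F,c₁,c₂,c₃]) :
    (basisOneIJK c₁ c₂ c₃).det ![1, star g * h, g', h'] +
      (basisOneIJK c₁ c₂ c₃).det ![g, h, 1, h' * star g'] =
      (basisOneIJK c₁ c₂ c₃).det ![g, h, g', h'] := by
  simp only [det_basisOneIJK, Matrix.det_succ_row_zero, Fin.sum_univ_succ]
  simp [Fin.succAbove]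
  ring

theorem mul_eq_zero_of_mem_wedgeRelations {x y : ⋀[F]^2 ℍ[F,c₁,c₂,c₃]}
    (hx : x ∈ wedgeRelations 1 fun g h => star g * h)
    (hy : y ∈ wedgeRelations 1 fun g h => h * star g) :
    (x : ExteriorAlgebra F ℍ[F,c₁,c₂,c₃]) * y = 0 := by
  induction hx, hy using Submodule.span_induction₂ with
  | mem_mem x y hx hy =>
    obtain ⟨⟨g, h⟩, rfl⟩ := hx
    obtain ⟨⟨g', h'⟩, rfl⟩ := hy
    simp only [AddSubgroupClass.coe_sub, sub_mul, mul_sub,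
      coe_wedge_mul_coe_wedge_eq_det_smul (basisOneIJK c₁ c₂ c₃), ← sub_smul]
    rw [← det_star_mul_add_det_mul_star g h g' h',
      (basisOneIJK c₁ c₂ c₃).det.map_eq_zero_of_eq ![1, star g * h, 1, h' * star g']
        (i := 0) (j := 2) rfl (by decide)]
    simp
  | zero_left y hy => simp
  | zero_right x hx => simp
  | add_left x y z _ _ _ h₁ h₂ => simp [add_mul, h₁, h₂]
  | add_right x y z _ _ _ h₁ h₂ => simp [mul_add, h₁, h₂]
  | smul_left a x y _ _ h => simp [h]
  | smul_right a x y _ _ h => simp [h]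

theorem mem_span_one_of_wedge_mul_eq_zero {v : ℍ[F,c₁,c₂,c₃]}
    (hv : ∀ g h : ℍ[F,c₁,c₂,c₃], ((wedge g h : ⋀[F]^2 ℍ[F,c₁,c₂,c₃]) :
      ExteriorAlgebra F ℍ[F,c₁,c₂,c₃]) * (wedge 1 v : ⋀[F]^2 ℍ[F,c₁,c₂,c₃]) = 0) :
    v ∈ Submodule.span F {(1 : ℍ[F,c₁,c₂,c₃])} := by
  have hdet (g h : ℍ[F,c₁,c₂,c₃]) : (basisOneIJK c₁ c₂ c₃).det ![g, h, 1, v] = 0 :=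
    det_eq_zero_of_ιMulti_eq_zero _ (by rw [← coe_wedge_mul_coe_wedge]; exact hv g h)
  have hjk := hdet ⟨0, 0, 1, 0⟩ ⟨0, 0, 0, 1⟩
  have hik := hdet ⟨0, 1, 0, 0⟩ ⟨0, 0, 0, 1⟩
  have hij := hdet ⟨0, 1, 0, 0⟩ ⟨0, 0, 1, 0⟩
  simp only [det_basisOneIJK, Matrix.det_succ_row_zero, Fin.sum_univ_succ] at hjk hik hij
  simp [Fin.succAbove] at hjk hik hij
  exact mem_span_one_iff.2 ⟨hjk, hik, hij⟩

/-- The subspaces spanned by `g ∧ h - 1 ∧ star g * h` and by `g ∧ h - 1 ∧ h * star g` are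
mutually polar. -/
theorem mem_wedgeRelations_iff_forall_mul_eq_zero {y : ⋀[F]^2 ℍ[F,c₁,c₂,c₃]} :
    y ∈ wedgeRelations 1 (fun g h => h * star g) ↔
      ∀ x ∈ wedgeRelations (F := F) 1 (fun g h : ℍ[F,c₁,c₂,c₃] => star g * h),
        (x : ExteriorAlgebra F ℍ[F,c₁,c₂,c₃]) * y = 0 := by
  refine ⟨fun hy x hx => mul_eq_zero_of_mem_wedgeRelations hx hy, fun hy => ?_⟩
  obtain ⟨v, hv⟩ := exists_sub_wedge_mem_wedgeRelations 1 (fun g h => h * star g) y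
  have hv1 : v ∈ Submodule.span F {(1 : ℍ[F,c₁,c₂,c₃])} := by
    refine mem_span_one_of_wedge_mul_eq_zero fun g h => ?_
    have hx := wedge_sub_mem_wedgeRelations (F := F) (1 : ℍ[F,c₁,c₂,c₃])
      (fun g h => star g * h) g h
    have hxv := mul_eq_zero_of_mem_wedgeRelations hx hv
    rw [AddSubgroupClass.coe_sub y, mul_sub, hy _ hx, zero_sub, neg_eq_zero, AddSubgroupClass.coe_sub,
      sub_mul, coe_wedge_mul_coe_wedge 1,
      (ιMulti F 4).map_eq_zero_of_eq ![1, star g * h, 1, v] (i := 0) (j := 2) rfl (by decide),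
      sub_zero] at hxv
    exact hxv
  rwa [wedge_eq_zero_of_mem_span hv1, sub_zero] at hv

end QuaternionAlgebra


/-- The planes `C = ker κ` and `C' = ker κ'` are mutually polar with respect to the Klein
quadric: `y ∈ ker κ'` iff `x ∧ y = 0` (in the exterior algebra of `H`) for all
`x ∈ ker κ`. -/
theorem kerKappa_kerKappa'_mutually_polar (c₁ c₂ : F)
    (hdiv : ∀ a : ℍ[F,c₁,c₂], a ≠ 0 → IsUnit a)
    (κ : ↥(⋀[F]^2 ℍ[F,c₁,c₂]) →ₗ[F]
      (ℍ[F,c₁,c₂] ⧸ Submodule.span F {(1 : ℍ[F,c₁,c₂])}))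
    (hκ : ∀ (g h : ℍ[F,c₁,c₂]) (x : ⋀[F]^2 ℍ[F,c₁,c₂]),
      (x : ExteriorAlgebra F ℍ[F,c₁,c₂]) = ι F g * ι F h →
        κ x = Submodule.Quotient.mk (star g * h))
    (κ' : ↥(⋀[F]^2 ℍ[F,c₁,c₂]) →ₗ[F]
      (ℍ[F,c₁,c₂] ⧸ Submodule.span F {(1 : ℍ[F,c₁,c₂])}))
    (hκ' : ∀ (g h : ℍ[F,c₁,c₂]) (x : ⋀[F]^2 ℍ[F,c₁,c₂]),
      (x : ExteriorAlgebra F ℍ[F,c₁,c₂]) = ι F g * ι F h →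
        κ' x = Submodule.Quotient.mk (g * star h)) :
    ∀ y : ⋀[F]^2 ℍ[F,c₁,c₂],
      y ∈ LinearMap.ker κ' ↔
        ∀ x ∈ LinearMap.ker κ,
          (x : ExteriorAlgebra F ℍ[F,c₁,c₂]) * (y : ExteriorAlgebra F ℍ[F,c₁,c₂]) = 0 := by
  have hker : LinearMap.ker κ = wedgeRelations 1 fun g h => star g * h :=
    ker_eq_wedgeRelations κ
      (fun g h => by rw [hκ g h _ (coe_wedge g h), hκ 1 _ _ (coe_wedge 1 _), star_one, one_mul])
      fun v hv => by
        rwa [hκ 1 v _ (coe_wedge 1 v), star_one, one_mul, Submodule.Quotient.mk_eq_zero] at hv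
  have hker' : LinearMap.ker κ' = wedgeRelations 1 fun g h => h * star g :=
    ker_eq_wedgeRelations κ'
      (fun g h => by
        rw [hκ' g h _ (coe_wedge g h), hκ' 1 _ _ (coe_wedge 1 _), one_mul, star_mul, star_star])
      fun v hv => by
        rwa [hκ' 1 v _ (coe_wedge 1 v), one_mul, Submodule.Quotient.mk_eq_zero,
          QuaternionAlgebra.star_mem_span_one_iff] at hv
  intro y
  rw [hker, hker']
  exact QuaternionAlgebra.mem_wedgeRelations_iff_forall_mul_eq_zero
end
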